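/- Let X be a real Banach space, p ∈ (1,∞), μ ∈ (1/p,1], r ∈ (1/p,1) with r + μ > 1 + 1/p. Then there exists a constant C > 0, depending only on p, μ, r (independent of T ∈ (0,∞]), such that for every strongly measurable v : (0,T) → X satisfying ∫_0^T t^{-rp} ‖v(t)‖_X^p dt < ∞, the function (Φ_μ^{-1} v)(t) := t^{μ-1} v(t) satisfies (∫_0^T ∫_0^t s^{(1-μ)p} ‖t^{μ-1} v(t) - s^{μ-1} v(s)‖_X^p (t-s)^{-1-rp} ds dt)^{1/p} ≤ C ( (∫_0^T ‖v(t)‖_X^p dt)^{1/p} + (∫_0^T ∫_0^t ‖v(t)-v(s)‖_X^p (t-s)^{-1-rp} ds dt)^{1/p} ). -/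

import Mathlib

open MeasureTheory Set ENNReal

lemma aux_rpow_add {a b p : ℝ} (ha : 0 ≤ a) (hb : 0 ≤ b) (hp : 1 ≤ p) :
    (a + b) ^ p ≤ 2 ^ (p - 1) * (a ^ p + b ^ p) := by
  lift a to NNReal using ha
  lift b to NNReal using hb
  exact_mod_cast NNReal.rpow_add_le_mul_rpow_add_rpow a b hp

lemma aux_scale (g : ℝ → ℝ≥0∞) (hg : Measurable g) {a : ℝ} (ha : 0 < a) :
    ∫⁻ x, g (a * x) = ENNReal.ofReal a⁻¹ * ∫⁻ x, g x := by
  rw [← lintegral_map hg (measurable_const_mul a), Real.map_volume_mul_left ha.ne', lintegral_smul_measure,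
    abs_of_pos (inv_pos.2 ha), smul_eq_mul]

lemma aux_scale_set (g : ℝ → ℝ≥0∞) (hg : Measurable g) {a : ℝ} (ha : 0 < a) {b : ℝ} :
    ∫⁻ x in Ioo 0 b, g (a * x) = ENNReal.ofReal a⁻¹ * ∫⁻ s in Ioo 0 (a * b), g s := by
  rw [← lintegral_indicator measurableSet_Ioo, ← lintegral_indicator measurableSet_Ioo,
    ← aux_scale _ (hg.indicator measurableSet_Ioo) ha]
  congr 1; ext x
  simp only [indicator, mem_Ioo, mul_lt_mul_iff_right₀ ha, mul_pos_iff_of_pos_left ha]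

lemma aux_meas_D (T : ℝ≥0∞) : MeasurableSet {t : ℝ | 0 < t ∧ ENNReal.ofReal t < T} :=
  (measurableSet_lt measurable_const measurable_id).inter
    (measurableSet_lt ENNReal.measurable_ofReal measurable_const)

lemma aux_dilate {X : Type*} [NormedAddCommGroup X] {p r : ℝ} (hp : 1 < p)
    (hr : 1 / p < r) (T : ℝ≥0∞) (v : ℝ → X) (hv : StronglyMeasurable v) {x : ℝ} (hx : 0 < x)
    (hx2 : x < 1 / 2) :
    (∫⁻ t in {t : ℝ | 0 < t ∧ ENNReal.ofReal t < T},
              ENNReal.ofReal (t ^ (-(r * p)) * ‖v (x * t)‖ ^ p)) ≤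
    ENNReal.ofReal ((1/2 : ℝ) ^ (r * p - 1)) *
    (∫⁻ t in {t : ℝ | 0 < t ∧ ENNReal.ofReal t < T},
              ENNReal.ofReal (t ^ (-(r * p)) * ‖v t‖ ^ p)) := by
  have hm : Measurable (fun t => ENNReal.ofReal (t ^ (-(r * p)) * ‖v t‖ ^ p)) := by
    have := hv.norm.measurable
    fun_prop
  have hrp : 1 < r * p := by rwa [div_lt_iff₀ (by linarith)] at hr
  rw [← lintegral_indicator (aux_meas_D T), ← lintegral_indicator (aux_meas_D T)]
  calc _ ≤ ∫⁻ t, ENNReal.ofReal (x ^ (r * p)) * ({t : ℝ | 0 < t ∧ ENNReal.ofReal t < T}.indicator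
            (fun t => ENNReal.ofReal (t ^ (-(r * p)) * ‖v t‖ ^ p))) (x * t) := by
        apply lintegral_mono
        intro t
        dsimp only
        by_cases h : t ∈ {t : ℝ | 0 < t ∧ ENNReal.ofReal t < T}
        · have h' : x * t ∈ {t : ℝ | 0 < t ∧ ENNReal.ofReal t < T} :=
            ⟨mul_pos hx h.1, lt_of_le_of_lt (ENNReal.ofReal_le_ofReal (by nlinarith [h.1])) h.2⟩
          rw [indicator_of_mem h, indicator_of_mem h', ← ENNReal.ofReal_mul (by positivity)]
          apply le_of_eq
          congr 1
          rw [Real.mul_rpow hx.le h.1.le, ← mul_assoc, ← mul_assoc, ← Real.rpow_add hx]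
          simp
        · rw [indicator_of_notMem h]; exact zero_le
    _ ≤ _ := by
        rw [lintegral_const_mul' _ _ ENNReal.ofReal_ne_top,
          aux_scale _ (hm.indicator (aux_meas_D T)) hx, ← mul_assoc,
          ← ENNReal.ofReal_mul (by positivity)]
        gcongr
        rw [← Real.rpow_neg_one x, ← Real.rpow_add hx, ← sub_eq_add_neg]
        exact Real.rpow_le_rpow hx.le hx2.le (by linarith)

/-- Hardy-type estimate. -/
lemma aux_B {X : Type*} [NormedAddCommGroup X] {p r : ℝ} (hp : 1 < p)
    (hr : 1 / p < r) : ∃ δ : ℝ, 0 < δ ∧ ∀ (T : ℝ≥0∞) (v : ℝ → X) (hv : StronglyMeasurable v)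
    (hfin : (∫⁻ t in {t : ℝ | 0 < t ∧ ENNReal.ofReal t < T},
              ENNReal.ofReal (t ^ (-(r * p)) * ‖v t‖ ^ p)) < ⊤) {x : ℝ} (hx : 0 < x)
    (hx2 : x < 1 / 2),
    (∫⁻ t in {t : ℝ | 0 < t ∧ ENNReal.ofReal t < T},
              ENNReal.ofReal (t ^ (-(r * p)) * ‖v t‖ ^ p)) ≤
    ENNReal.ofReal δ *
    (∫⁻ t in {t : ℝ | 0 < t ∧ ENNReal.ofReal t < T},
              ENNReal.ofReal (t ^ (-(r * p)) * ‖v t - v (t * x)‖ ^ p)) := by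
  have hp0 : 0 < p := by linarith
  have hrp : 1 < r * p := by rwa [div_lt_iff₀ (by linarith)] at hr
  set c : ℝ := ((1/2 : ℝ) ^ (r * p - 1)) ^ (1 / p) with hc
  have hc0 : 0 < c := by positivity
  have hc1 : c < 1 := Real.rpow_lt_one (by positivity)
    (Real.rpow_lt_one (by norm_num) (by norm_num) (by linarith)) (by positivity)
  refine ⟨((1 - c)⁻¹) ^ p, by have := sub_pos.2 hc1; positivity, ?_⟩
  intro T v hv hfin x hx hx2
  set D := {t : ℝ | 0 < t ∧ ENNReal.ofReal t < T} with hD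
  set H := (∫⁻ t in D, ENNReal.ofReal (t ^ (-(r * p)) * ‖v t‖ ^ p)) with hH
  set B := (∫⁻ t in D, ENNReal.ofReal (t ^ (-(r * p)) * ‖v t - v (t * x)‖ ^ p)) with hB
  have hvx : StronglyMeasurable (fun t => v (t * x)) :=
    hv.comp_measurable (measurable_id.mul_const x)
  let f : ℝ → ℝ≥0∞ := fun t => ENNReal.ofReal (t ^ (-r) * ‖v t - v (t * x)‖)
  let g : ℝ → ℝ≥0∞ := fun t => ENNReal.ofReal (t ^ (-r) * ‖v (x * t)‖)
  have hf : Measurable f := by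
    have := (hv.sub hvx).norm.measurable
    have h2 : Measurable (fun t : ℝ => ‖v t - v (t * x)‖) := this
    fun_prop
  have hg : Measurable g := by
    have h2 : Measurable (fun t : ℝ => ‖v (x * t)‖) := by
      simpa only [mul_comm] using hvx.norm.measurable
    fun_prop
  have key : ∀ t ∈ D, ∀ y : ℝ, 0 ≤ y → ENNReal.ofReal (t ^ (-(r * p)) * y ^ p)
      = ENNReal.ofReal (t ^ (-r) * y) ^ p := by
    intro t ht y hy
    have := ht.1
    rw [ENNReal.ofReal_rpow_of_nonneg (by positivity) hp0.le, Real.mul_rpow (by positivity) hy,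
      ← Real.rpow_mul this.le]
    congr 3; ring
  have hmink : H ^ (1 / p) ≤ B ^ (1 / p) + ENNReal.ofReal c * H ^ (1 / p) := by
    calc H ^ (1 / p) ≤ (∫⁻ t in D, (f + g) t ^ p) ^ (1 / p) := by
          gcongr
          apply setLIntegral_mono ((hf.add hg).pow_const p)
          intro t ht
          have := ht.1
          rw [key t ht _ (norm_nonneg _)]
          gcongr
          simp only [f, g, Pi.add_apply]
          rw [← ENNReal.ofReal_add (by positivity) (by positivity), ← mul_add, mul_comm x t]
          gcongr
          simpa using norm_add_le (v t - v (t * x)) (v (t * x))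
      _ ≤ _ := ENNReal.lintegral_Lp_add_le hf.aemeasurable hg.aemeasurable hp.le
      _ ≤ _ := by
          gcongr
          · apply setLIntegral_mono' (aux_meas_D T)
            intro t ht
            exact (key t ht _ (norm_nonneg _)).ge
          · rw [hc, ← ENNReal.ofReal_rpow_of_nonneg (by positivity) (by positivity),
              ← ENNReal.mul_rpow_of_nonneg _ _ (by positivity)]
            gcongr
            refine le_trans (le_of_eq ?_) (aux_dilate hp hr T v hv hx hx2)
            apply setLIntegral_congr_fun (aux_meas_D T)
            intro t ht
            exact (key t ht _ (norm_nonneg _)).symm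
  have hHt : H ^ (1 / p) ≠ ⊤ := (ENNReal.rpow_lt_top_of_nonneg (by positivity) hfin.ne).ne
  have h2 : ENNReal.ofReal (1 - c) * H ^ (1 / p) ≤ B ^ (1 / p) := by
    rw [ENNReal.ofReal_sub _ hc0.le, ENNReal.ofReal_one, ENNReal.sub_mul (fun _ _ => hHt), one_mul]
    exact tsub_le_iff_right.2 hmink
  have h3 : H ^ (1 / p) ≤ ENNReal.ofReal (1 - c)⁻¹ * B ^ (1 / p) := by
    calc H ^ (1 / p) = ENNReal.ofReal (1 - c)⁻¹ * (ENNReal.ofReal (1 - c) * H ^ (1 / p)) := by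
          have := sub_pos.2 hc1
          rw [← mul_assoc, ← ENNReal.ofReal_mul (by positivity), inv_mul_cancel₀ this.ne']
          simp
      _ ≤ _ := by gcongr
  have h4 := ENNReal.rpow_le_rpow h3 hp0.le
  have := sub_pos.2 hc1
  rwa [ENNReal.mul_rpow_of_nonneg _ _ hp0.le, ← ENNReal.rpow_mul, ← ENNReal.rpow_mul,
    one_div_mul_cancel hp0.ne', ENNReal.rpow_one, ENNReal.rpow_one,
    ENNReal.ofReal_rpow_of_nonneg (by positivity) hp0.le] at h4

/-- Hardy-type estimate. -/
lemma aux_Hardy {X : Type*} [NormedAddCommGroup X] {p r : ℝ} (hp : 1 < p)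
    (hr : 1 / p < r) : ∃ δ : ℝ, 0 < δ ∧ ∀ (T : ℝ≥0∞) (v : ℝ → X) (hv : StronglyMeasurable v)
    (hfin : (∫⁻ t in {t : ℝ | 0 < t ∧ ENNReal.ofReal t < T},
              ENNReal.ofReal (t ^ (-(r * p)) * ‖v t‖ ^ p)) < ⊤),
    (∫⁻ t in {t : ℝ | 0 < t ∧ ENNReal.ofReal t < T},
              ENNReal.ofReal (t ^ (-(r * p)) * ‖v t‖ ^ p)) ≤
    ENNReal.ofReal δ *
    ∫⁻ t in {t : ℝ | 0 < t ∧ ENNReal.ofReal t < T},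
                    ∫⁻ s in Ioo (0 : ℝ) t,
                      ENNReal.ofReal (‖v t - v s‖ ^ p / (t - s) ^ (1 + r * p)) := by
  obtain ⟨δ, hδ, h⟩ := aux_B (X := X) hp hr
  refine ⟨2 * δ, by positivity, ?_⟩
  intro T v hv hfin
  have hp0 : 0 < p := by linarith
  have hrp : 1 < r * p := by rwa [div_lt_iff₀ (by linarith)] at hr
  set D := {t : ℝ | 0 < t ∧ ENNReal.ofReal t < T} with hD
  set H := (∫⁻ t in D, ENNReal.ofReal (t ^ (-(r * p)) * ‖v t‖ ^ p)) with hH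
  have hmj : Measurable (fun z : ℝ × ℝ => ENNReal.ofReal (z.2 ^ (-(r * p)) *
      ‖v z.2 - v (z.2 * z.1)‖ ^ p)) := by
    have h2 : Measurable (fun z : ℝ × ℝ => ‖v z.2 - v (z.2 * z.1)‖) :=
      ((hv.comp_measurable measurable_snd).sub
        (hv.comp_measurable (measurable_snd.mul measurable_fst))).norm.measurable
    fun_prop
  have h1 : ∫⁻ x in Ioo (0:ℝ) (1/2), H ≤ ∫⁻ x in Ioo (0:ℝ) (1/2), ENNReal.ofReal δ *
      (∫⁻ t in D, ENNReal.ofReal (t ^ (-(r * p)) * ‖v t - v (t * x)‖ ^ p)) :=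
    setLIntegral_mono' measurableSet_Ioo (fun x hx => h T v hv hfin hx.1 hx.2)
  rw [lintegral_const_mul _ hmj.lintegral_prod_right',
    lintegral_lintegral_swap (f := fun x t => ENNReal.ofReal (t ^ (-(r * p)) *
      ‖v t - v (t * x)‖ ^ p)) hmj.aemeasurable, setLIntegral_const, Real.volume_Ioo] at h1
  have h2 : ∫⁻ t in D, ∫⁻ x in Ioo (0:ℝ) (1/2),
        ENNReal.ofReal (t ^ (-(r * p)) * ‖v t - v (t * x)‖ ^ p) ≤
      ∫⁻ t in D, ∫⁻ s in Ioo (0 : ℝ) t,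
        ENNReal.ofReal (‖v t - v s‖ ^ p / (t - s) ^ (1 + r * p)) := by
    apply setLIntegral_mono' (aux_meas_D T)
    intro t ht
    have ht0 : 0 < t := ht.1
    have hms : Measurable (fun s => ENNReal.ofReal (t ^ (-(r * p)) * ‖v t - v s‖ ^ p)) := by
      have h2 : Measurable (fun s => ‖v t - v s‖) :=
        (stronglyMeasurable_const.sub hv).norm.measurable
      fun_prop
    rw [aux_scale_set _ hms ht0, ← lintegral_const_mul _ hms]
    refine le_trans ?_ (lintegral_mono_set (Ioo_subset_Ioo_right (by linarith : t * (1/2) ≤ t)))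
    apply setLIntegral_mono' measurableSet_Ioo
    intro s hs
    have hs1 : 0 < t - s := by have := hs.2; linarith
    rw [← ENNReal.ofReal_mul (by positivity)]
    apply ENNReal.ofReal_le_ofReal
    rw [← mul_assoc, ← Real.rpow_neg_one t, ← Real.rpow_add ht0, mul_comm, div_eq_mul_inv,
      show -1 + -(r * p) = -(1 + r * p) by ring, Real.rpow_neg ht0.le]
    gcongr
    linarith [hs.1]
  calc H = ENNReal.ofReal 2 * (H * ENNReal.ofReal (1 / 2 - 0)) := by
        rw [mul_comm H, ← mul_assoc, ← ENNReal.ofReal_mul (by positivity)]; norm_num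
    _ ≤ ENNReal.ofReal 2 * (ENNReal.ofReal δ * ∫⁻ t in D, ∫⁻ s in Ioo (0 : ℝ) t,
        ENNReal.ofReal (‖v t - v s‖ ^ p / (t - s) ^ (1 + r * p))) := by
        exact mul_le_mul_right (h1.trans (mul_le_mul_right h2 _)) _
    _ = _ := by rw [← mul_assoc, ← ENNReal.ofReal_mul (by positivity)]

lemma aux_int {t q : ℝ} (ht : 0 < t) (hq : 0 < q) :
    ∫⁻ s in Ioo (0:ℝ) t, ENNReal.ofReal ((t - s) ^ (q - 1)) = ENNReal.ofReal (t ^ q / q) := by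
  have hi : IntervalIntegrable (fun s : ℝ => (t - s) ^ (q - 1)) volume 0 t := by
    have := (intervalIntegral.intervalIntegrable_rpow' (a := 0) (b := t)
      (show -1 < q - 1 by linarith)).comp_sub_left t
    simpa using this.symm
  rw [← ofReal_integral_eq_lintegral_ofReal, ← integral_Ioc_eq_integral_Ioo,
    ← intervalIntegral.integral_of_le ht.le,
    intervalIntegral.integral_comp_sub_left (fun s => s ^ (q - 1)) t,
    integral_rpow (Or.inl (by linarith))]
  · simp [hq.ne']
  · exact ((intervalIntegrable_iff_integrableOn_Ioc_of_le ht.le).1 hi).mono_set Ioo_subset_Ioc_self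
  · filter_upwards [self_mem_ae_restrict measurableSet_Ioo] with s hs
    exact Real.rpow_nonneg (by linarith [hs.2]) _

lemma aux_pt {X : Type*} [NormedAddCommGroup X] [NormedSpace ℝ X] {p μ r : ℝ} (hp : 1 < p)
    (hμ : 0 < μ) (hμ1 : μ ≤ 1) {s t : ℝ} (hs : 0 < s) (hst : s < t) (a b : X) :
    s ^ ((1 - μ) * p) * ‖t ^ (μ - 1) • a - s ^ (μ - 1) • b‖ ^ p / (t - s) ^ (1 + r * p)
    ≤ 2 ^ (p - 1) * (‖a - b‖ ^ p / (t - s) ^ (1 + r * p) +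
        (t ^ (-p) * ‖a‖ ^ p) * (t - s) ^ ((p * (1 - r)) - 1)) := by
  have ht : 0 < t := hs.trans hst
  have hts : 0 < t - s := sub_pos.2 hst
  have hp0 : 0 < p := by linarith
  have e1 : s ^ ((1 - μ) * p) * ‖t ^ (μ - 1) • a - s ^ (μ - 1) • b‖ ^ p
      = ‖((s / t) ^ (1 - μ)) • a - b‖ ^ p := by
    rw [Real.rpow_mul hs.le, ← Real.mul_rpow (by positivity) (by positivity)]
    congr 1
    rw [← Real.norm_of_nonneg (show 0 ≤ s ^ (1 - μ) by positivity), ← norm_smul,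
      smul_sub, smul_smul, smul_smul,
      ← Real.rpow_add hs, Real.div_rpow hs.le ht.le, show μ - 1 = -(1 - μ) by ring,
      Real.rpow_neg ht.le, div_eq_mul_inv]
    simp
  have hx0 : 0 < s / t := by positivity
  have hx1 : s / t ≤ 1 := (div_le_one ht).2 hst.le
  have e2 : ‖((s / t) ^ (1 - μ)) • a - b‖ ≤ ‖a - b‖ + (t - s) / t * ‖a‖ := by
    have : ((s / t) ^ (1 - μ)) • a - b = (a - b) + (-(1 - (s / t) ^ (1 - μ))) • a := by
      module
    rw [this]
    refine (norm_add_le _ _).trans ?_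
    gcongr
    rw [norm_smul, norm_neg]
    gcongr
    have h1 : (s / t) ^ (1 - μ) ≤ 1 := Real.rpow_le_one hx0.le hx1 (by linarith)
    have h2 : s / t ≤ (s / t) ^ (1 - μ) := by
      simpa using Real.rpow_le_rpow_of_exponent_ge hx0 hx1 (show 1 - μ ≤ 1 by linarith)
    rw [Real.norm_of_nonneg (by linarith), sub_div, div_self ht.ne']
    linarith
  rw [e1]
  have e3 : ‖((s / t) ^ (1 - μ)) • a - b‖ ^ p ≤
      2 ^ (p - 1) * (‖a - b‖ ^ p + ((t - s) / t * ‖a‖) ^ p) :=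
    (Real.rpow_le_rpow (norm_nonneg _) e2 hp0.le).trans
      (aux_rpow_add (by positivity) (by positivity) hp.le)
  calc _ ≤ 2 ^ (p - 1) * (‖a - b‖ ^ p + ((t - s) / t * ‖a‖) ^ p) / (t - s) ^ (1 + r * p) := by
        gcongr
    _ = _ := by
        rw [mul_div_assoc, add_div, Real.mul_rpow (by positivity) (by positivity),
          Real.div_rpow hts.le ht.le, show p * (1 - r) - 1 = p - (1 + r * p) by ring,
          Real.rpow_sub hts, Real.rpow_neg ht.le]
        ring

theorem stmt_5 {X : Type*} [NormedAddCommGroup X] [NormedSpace ℝ X] [CompleteSpace X]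
    (p μ r : ℝ) (hp : 1 < p) (hμ : 1 / p < μ) (hμ1 : μ ≤ 1)
    (hr : 1 / p < r) (hr1 : r < 1) (hrμ : 1 + 1 / p < r + μ) :
    ∃ C : ℝ, 0 < C ∧
      ∀ (T : ℝ≥0∞), 0 < T →
        ∀ v : ℝ → X, StronglyMeasurable v →
          (∫⁻ t in {t : ℝ | 0 < t ∧ ENNReal.ofReal t < T},
              ENNReal.ofReal (t ^ (-(r * p)) * ‖v t‖ ^ p)) < ⊤ →
          (∫⁻ t in {t : ℝ | 0 < t ∧ ENNReal.ofReal t < T},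
              ∫⁻ s in Ioo (0 : ℝ) t,
                ENNReal.ofReal
                  (s ^ ((1 - μ) * p) * ‖t ^ (μ - 1) • v t - s ^ (μ - 1) • v s‖ ^ p
                    / (t - s) ^ (1 + r * p)))
            ^ (1 / p)
            ≤ ENNReal.ofReal C *
              ((∫⁻ t in {t : ℝ | 0 < t ∧ ENNReal.ofReal t < T},
                  ENNReal.ofReal (‖v t‖ ^ p)) ^ (1 / p)
               + (∫⁻ t in {t : ℝ | 0 < t ∧ ENNReal.ofReal t < T},
                    ∫⁻ s in Ioo (0 : ℝ) t,
                      ENNReal.ofReal (‖v t - v s‖ ^ p / (t - s) ^ (1 + r * p)))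
                 ^ (1 / p)) := by
  obtain ⟨δ, hδ, h⟩ := aux_Hardy (X := X) hp hr
  have hp0 : 0 < p := by linarith
  have hμ0 : 0 < μ := lt_trans (by positivity) hμ
  set q := p * (1 - r) with hq
  have hq0 : 0 < q := mul_pos hp0 (by linarith)
  refine ⟨(2 ^ (p - 1) * (1 + q⁻¹ * δ)) ^ (1 / p), by positivity, ?_⟩
  intro T _ v hv hfin
  have hH := h T v hv hfin
  set D := {t : ℝ | 0 < t ∧ ENNReal.ofReal t < T} with hD
  set H := (∫⁻ t in D, ENNReal.ofReal (t ^ (-(r * p)) * ‖v t‖ ^ p)) with hHd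
  set S := ∫⁻ t in D, ∫⁻ s in Ioo (0 : ℝ) t,
        ENNReal.ofReal (‖v t - v s‖ ^ p / (t - s) ^ (1 + r * p)) with hS
  have hmH : Measurable (fun t => ENNReal.ofReal (t ^ (-(r * p)) * ‖v t‖ ^ p)) := by
    have := hv.norm.measurable
    fun_prop
  have main : (∫⁻ t in D, ∫⁻ s in Ioo (0 : ℝ) t, ENNReal.ofReal
      (s ^ ((1 - μ) * p) * ‖t ^ (μ - 1) • v t - s ^ (μ - 1) • v s‖ ^ p / (t - s) ^ (1 + r * p)))
      ≤ ENNReal.ofReal (2 ^ (p - 1)) * (S + ENNReal.ofReal q⁻¹ * H) := by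
    rw [hS, hHd, ← lintegral_const_mul _ hmH, ← lintegral_add_right _ (hmH.const_mul _),
      ← lintegral_const_mul' _ _ ENNReal.ofReal_ne_top]
    apply setLIntegral_mono' (aux_meas_D T)
    intro t ht
    have ht0 : 0 < t := ht.1
    have hm2 : Measurable (fun s => ENNReal.ofReal ((t - s) ^ (q - 1))) := by fun_prop
    have e : ENNReal.ofReal q⁻¹ * ENNReal.ofReal (t ^ (-(r * p)) * ‖v t‖ ^ p) =
        ∫⁻ s in Ioo (0:ℝ) t, ENNReal.ofReal (t ^ (-p) * ‖v t‖ ^ p) *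
          ENNReal.ofReal ((t - s) ^ (q - 1)) := by
      rw [lintegral_const_mul _ hm2, aux_int ht0 hq0, ← ENNReal.ofReal_mul (by positivity),
        ← ENNReal.ofReal_mul (by positivity), show -(r * p) = -p + q by rw [hq]; ring,
        Real.rpow_add ht0]
      congr 1; ring
    rw [e, ← lintegral_add_right _ (hm2.const_mul _),
      ← lintegral_const_mul' _ _ ENNReal.ofReal_ne_top]
    apply setLIntegral_mono' measurableSet_Ioo
    intro s hs
    have hs1 : 0 < t - s := sub_pos.2 hs.2
    rw [← ENNReal.ofReal_mul (by positivity), ← ENNReal.ofReal_add (by positivity) (by positivity),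
      ← ENNReal.ofReal_mul (by positivity)]
    exact ENNReal.ofReal_le_ofReal (aux_pt hp hμ0 hμ1 hs.1 hs.2 _ _)
  have main2 : (∫⁻ t in D, ∫⁻ s in Ioo (0 : ℝ) t, ENNReal.ofReal
      (s ^ ((1 - μ) * p) * ‖t ^ (μ - 1) • v t - s ^ (μ - 1) • v s‖ ^ p / (t - s) ^ (1 + r * p)))
      ≤ ENNReal.ofReal (2 ^ (p - 1) * (1 + q⁻¹ * δ)) * S := by
    refine main.trans ?_
    rw [ENNReal.ofReal_mul (by positivity), mul_assoc, ENNReal.ofReal_add (by positivity)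
      (by positivity), add_mul, ENNReal.ofReal_one, one_mul, ENNReal.ofReal_mul (by positivity),
      mul_assoc]
    gcongr
  refine (ENNReal.rpow_le_rpow main2 (by positivity)).trans ?_
  rw [ENNReal.mul_rpow_of_nonneg _ _ (by positivity),
    ENNReal.ofReal_rpow_of_nonneg (by positivity) (by positivity)]
  gcongr
  exact le_add_self
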